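/- Let A be an n×n real symmetric matrix with all eigenvalues positive, let λ_min and λ_max denote its smallest and largest eigenvalue respectively, and let B be an n×n real symmetric matrix. Then trace(AB(AB)ᵀ) ≤ n·(λ_max/λ_min)²·trace((AB)²). -/

import Mathlib

open Matrix in
/-- A real symmetric matrix is orthogonally similar to the diagonal matrix of its eigenvalues. -/
theorem Matrix.IsHermitian.exists_orthogonal_diagonalization {ι : Type*} [Fintype ι]
    [DecidableEq ι] {A : Matrix ι ι ℝ} (hA : A.IsHermitian) :
    ∃ U : Matrix ι ι ℝ, U * Uᵀ = 1 ∧ Uᵀ * U = 1 ∧ A = U * diagonal hA.eigenvalues * Uᵀ := by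
  refine ⟨hA.eigenvectorUnitary, ?_, ?_, ?_⟩
  · simpa [star_eq_conjTranspose] using Unitary.coe_mul_star_self hA.eigenvectorUnitary
  · simpa [star_eq_conjTranspose] using Unitary.coe_star_mul_self hA.eigenvectorUnitary
  · have h := hA.spectral_theorem
    rw [Unitary.conjStarAlgAut_apply] at h
    simpa [star_eq_conjTranspose, Function.comp_def] using h

open Matrix in
/-- The trace inequality for a diagonal matrix with entries in `[a, b]`, where `0 < a`. -/
theorem Matrix.trace_diagonal_mul_mul_transpose_le {ι : Type*} [Fintype ι] [DecidableEq ι]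
    {d : ι → ℝ} {a b : ℝ} (ha : 0 < a) (hd : ∀ i, a ≤ d i) (hd' : ∀ i, d i ≤ b)
    {C : Matrix ι ι ℝ} (hC : Cᵀ = C) :
    (diagonal d * C * (diagonal d * C)ᵀ).trace ≤
      (b / a) ^ 2 * ((diagonal d * C) ^ 2).trace := by
  simp only [trace, diag_apply, sq (diagonal d * C), mul_apply (M := diagonal d * C),
    transpose_apply, diagonal_mul, Finset.mul_sum]
  refine Finset.sum_le_sum fun i _ => Finset.sum_le_sum fun j _ => ?_
  have hij : C j i = C i j := congrFun (congrFun hC i) j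
  have h₁ : d i ^ 2 ≤ b ^ 2 := pow_le_pow_left₀ (ha.le.trans (hd i)) (hd' i) 2
  have h₂ : a ^ 2 ≤ d i * d j := by
    rw [sq]
    exact mul_le_mul (hd i) (hd j) ha.le (ha.le.trans (hd i))
  calc d i * C i j * (d i * C i j) = d i ^ 2 * C i j ^ 2 := by ring
    _ ≤ b ^ 2 * C i j ^ 2 := by gcongr
    _ = (b / a) ^ 2 * (a ^ 2 * C i j ^ 2) := by field_simp
    _ ≤ (b / a) ^ 2 * (d i * d j * C i j ^ 2) := by gcongr
    _ = (b / a) ^ 2 * (d i * C i j * (d j * C j i)) := by rw [hij]; ring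

open Matrix in
/-- Lemma 3.4 (Antonini–Kolev–Mantegazza, Catino–Mantegazza): if `A` is
symmetric with positive eigenvalues, with smallest eigenvalue `λ_min` and
largest eigenvalue `λ_max`, and `B` is symmetric, then
`trace(AB(AB)ᵀ) ≤ n (λ_max/λ_min)² trace((AB)²)`. -/
theorem trace_inequality (n : ℕ) (A B : Matrix (Fin n) (Fin n) ℝ)
    (hA : A.IsHermitian) (hB : B.IsHermitian)
    (hpos : ∀ i, 0 < hA.eigenvalues i)
    (lmin lmax : ℝ)
    (hmin : IsLeast (Set.range hA.eigenvalues) lmin)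
    (hmax : IsGreatest (Set.range hA.eigenvalues) lmax) :
    (A * B * (A * B)ᵀ).trace ≤ (n : ℝ) * (lmax / lmin) ^ 2 * ((A * B) ^ 2).trace := by
  have hle := fun i => hmin.2 (Set.mem_range_self i)
  have hge := fun i => hmax.2 (Set.mem_range_self i)
  obtain ⟨i₀, hi₀⟩ := hmin.1
  have ha : 0 < lmin := hi₀ ▸ hpos i₀
  have hn : (1 : ℝ) ≤ n := by exact_mod_cast i₀.pos
  have hBT : Bᵀ = B := by simpa using hB.eq
  obtain ⟨U, hU, hU', hAU⟩ := hA.exists_orthogonal_diagonalization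
  have hC : (Uᵀ * B * U)ᵀ = Uᵀ * B * U := by
    simp [transpose_mul, hBT, Matrix.mul_assoc]
  have key := trace_diagonal_mul_mul_transpose_le ha hle hge hC
  set M := diagonal hA.eigenvalues * (Uᵀ * B * U) with hM
  have hAB : A * B = U * M * Uᵀ := by
    calc A * B = U * diagonal hA.eigenvalues * Uᵀ * B * (U * Uᵀ) := by
          rw [hU, Matrix.mul_one, ← hAU]
      _ = U * M * Uᵀ := by simp only [hM, Matrix.mul_assoc]
  have trace_conj (X : Matrix (Fin n) (Fin n) ℝ) : (U * X * Uᵀ).trace = X.trace := by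
    rw [trace_mul_comm, ← Matrix.mul_assoc, hU', Matrix.one_mul]
  have mul_conj (X Y : Matrix (Fin n) (Fin n) ℝ) :
      U * X * Uᵀ * (U * Y * Uᵀ) = U * (X * Y) * Uᵀ := by
    calc U * X * Uᵀ * (U * Y * Uᵀ) = U * X * (Uᵀ * U) * Y * Uᵀ := by
          simp only [Matrix.mul_assoc]
      _ = U * (X * Y) * Uᵀ := by rw [hU', Matrix.mul_one, Matrix.mul_assoc U]
  have hT : (U * M * Uᵀ)ᵀ = U * Mᵀ * Uᵀ := by
    simp [transpose_mul, Matrix.mul_assoc]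
  rw [hAB, hT, sq (U * M * Uᵀ), mul_conj, mul_conj, trace_conj, trace_conj, ← sq M, mul_assoc (n : ℝ)]
  have h0 : 0 ≤ (M * Mᵀ).trace := by
    simpa using (posSemidef_self_mul_conjTranspose M).trace_nonneg
  exact key.trans (le_mul_of_one_le_left (h0.trans key) hn)
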